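/- arXiv:2101.01003 — 2 statements merged into one kernel-verified Lean document; each statement's English description precedes it below -/
import Mathlib

section
/- Let a ∈ GF(Q)* with A_m(a) = 0. Then X^{q^N} - X = G_2(F_1(X)) = F_1(G_2(X)) = L_a(G_1(G_2(X))) in GF(Q)[X]; consequently, {x in the algebraic closure of GF(p) : F_1(x) = 0} = G_2(GF(q^N)) and {x in the algebraic closure of GF(p) : L_a(x) = 0} = G_1(G_2(GF(q^N))). -/
open Polynomial

section Recurrence

variable {R : Type*} [CommRing R] (φ : R →+* R) {a : R} {c : ℕ → R}

/-- The twisted recurrence for `c` implies a recurrence that twists only the parameter `a`. -/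
lemma twisted_recurrence_dual (h0 : c 0 = 0) (h1 : c 1 = 1)
    (hc : ∀ r, c (r + 2) = -φ (c (r + 1)) - φ a * φ (φ (c r))) (r : ℕ) :
    c (r + 2) = -c (r + 1) - φ^[r] a * c r := by
  induction r using Nat.strong_induction_on with
  | _ r ih =>
    match r with
    | 0 => simp [hc 0, h0, h1]
    | 1 => simp [hc 1, hc 0, h0, h1]
    | r + 2 =>
      have e1 := congrArg φ (ih (r + 1) (by omega))
      have e2 := congrArg (fun x => φ (φ x)) (ih r (by omega))
      simp only [map_sub, map_neg, map_mul, ← Function.iterate_succ_apply' φ] at e1 e2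
      linear_combination hc (r + 2) - e1 - φ a * e2 + hc (r + 1) + φ^[r + 2] a * hc r

lemma iterate_of_twisted_root (h0 : c 0 = 0) (h1 : c 1 = 1)
    (hc : ∀ r, c (r + 2) = -φ (c (r + 1)) - φ a * φ (φ (c r)))
    {x : R} (hx : φ (φ x) + φ x + a * x = 0) (r : ℕ) :
    φ^[r + 1] x = c (r + 1) * φ x - a * φ (c r) * x := by
  induction r with
  | zero => simp [h0, h1]
  | succ r ih =>
    rw [Function.iterate_succ_apply', ih]
    simp only [map_sub, map_mul]
    linear_combination φ (c (r + 1)) * hx - φ x * hc r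

lemma iterate_coeff_relation (h0 : c 0 = 0) (h1 : c 1 = 1)
    (hc : ∀ r, c (r + 2) = -φ (c (r + 1)) - φ a * φ (φ (c r)))
    {m : ℕ} (ham : φ^[m] a = a) {j : ℕ} (hj : j + 2 ≤ m) :
    φ (φ (φ^[j] (c (m - j)))) + φ (φ^[j + 1] (c (m - (j + 1)))) +
      a * φ^[j + 2] (c (m - (j + 2))) = 0 := by
  obtain ⟨r, rfl⟩ := Nat.exists_eq_add_of_le' hj
  have e := congrArg φ^[j + 2] (twisted_recurrence_dual φ h0 h1 hc r)
  rw [iterate_map_sub φ, iterate_map_neg φ, iterate_map_mul φ, ← Function.iterate_add_apply,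
    show j + 2 + r = r + (j + 2) by omega, ham] at e
  rw [show r + (j + 2) - j = r + 2 by omega, show r + (j + 2) - (j + 1) = r + 1 by omega,
    show r + (j + 2) - (j + 2) = r by omega]
  simp only [← Function.iterate_succ_apply' φ]
  linear_combination e

end Recurrence

/-- If `c` vanishes at `M + 1`, then `φ^[M + 1]` acts on the roots of `φ² + φ + a` as a nonzero
scalar fixed by `φ`. -/
lemma twisted_eigenvalue_fixed {K : Type*} [Field K] (φ : K →+* K) {a : K} {c : ℕ → K}
    (h0 : c 0 = 0) (h1 : c 1 = 1)
    (hc : ∀ r, c (r + 2) = -φ (c (r + 1)) - φ a * φ (φ (c r)))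
    {M : ℕ} (ham : φ^[M + 1] a = a) (hcM : c (M + 1) = 0)
    {x : K} (hx0 : x ≠ 0) (hx : φ (φ x) + φ x + a * x = 0) :
    φ (-a * φ (c M)) = -a * φ (c M) ∧ -a * φ (c M) ≠ 0 := by
  set b := -a * φ (c M) with hb
  clear_value b
  have hxb : φ^[M + 1] x = b * x := by
    rw [iterate_of_twisted_root φ h0 h1 hc hx, hcM, hb]; ring
  have hb1 : φ b = -φ^[M] a * c M := by
    have e1 := hc M
    have e2 := twisted_recurrence_dual φ h0 h1 hc M
    rw [hcM] at e1 e2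
    rw [hb, map_mul, map_neg]
    rw [map_zero] at e1
    linear_combination e2 - e1
  have hb2 : φ (φ b) = b := by
    rw [hb1, map_mul, map_neg, ← Function.iterate_succ_apply' φ, ham, hb]
  have hφx : φ x ≠ 0 := (map_ne_zero φ).2 hx0
  refine ⟨?_, fun h => ?_⟩
  · have e := congrArg φ^[M + 1] hx
    rw [iterate_map_add φ, iterate_map_add φ, iterate_map_mul φ, iterate_map_zero φ, ham,
      ← Function.iterate_succ_apply, ← Function.iterate_succ_apply,
      ← Function.iterate_succ_apply, Function.iterate_succ_apply', Function.iterate_succ_apply',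
      hxb, map_mul, map_mul, hb2] at e
    have : (φ b - b) * φ x = 0 := by linear_combination e - b * hx
    exact sub_eq_zero.1 ((mul_eq_zero.1 this).resolve_right hφx)
  · have : Function.Injective φ^[M + 1] := φ.injective.iterate _
    rw [h, zero_mul] at hxb
    exact hx0 (this (hxb.trans (iterate_map_zero φ _).symm))

/-- A nonzero root of `X ^ q ^ 2 + X ^ q + a X`. -/
lemma exists_ne_zero_twisted_root {K : Type*} [Field K] [IsAlgClosed K] {q : ℕ} (hq : 2 ≤ q)
    {a : K} (ha : a ≠ 0) : ∃ x : K, x ≠ 0 ∧ x ^ q ^ 2 + x ^ q + a * x = 0 := by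
  have hq2 : q < q ^ 2 := by nlinarith
  have hdeg : (X ^ (q ^ 2 - 1) + (X ^ (q - 1) + C a) : K[X]).degree = (q ^ 2 - 1 : ℕ) := by
    rw [degree_add_eq_left_of_degree_lt, degree_X_pow]
    rw [degree_X_pow, degree_X_pow_add_C (by omega)]
    exact_mod_cast (by omega : q - 1 < q ^ 2 - 1)
  obtain ⟨x, hx⟩ := IsAlgClosed.exists_root (X ^ (q ^ 2 - 1) + (X ^ (q - 1) + C a) : K[X])
    (by rw [hdeg]; exact_mod_cast (by omega : q ^ 2 - 1 ≠ 0))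
  simp only [IsRoot, eval_add, eval_pow, eval_X, eval_C] at hx
  refine ⟨x, ?_, ?_⟩
  · rintro rfl
    rw [zero_pow (by omega), zero_pow (by omega)] at hx
    exact ha (by simpa using hx)
  · obtain ⟨s, hs⟩ : ∃ s, q = s + 1 := ⟨q - 1, by omega⟩
    obtain ⟨t, ht⟩ : ∃ t, q ^ 2 = t + 1 := ⟨q ^ 2 - 1, by omega⟩
    rw [ht] at hx ⊢
    rw [hs] at hx ⊢
    simp only [Nat.add_sub_cancel] at hx
    linear_combination x * hx

lemma pow_prime_pow_gcd_eq {K : Type*} [Monoid K] {p k n : ℕ} {b : K}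
    (hk : b ^ p ^ k = b) (hn : b ^ p ^ n = b) : b ^ p ^ Nat.gcd n k = b := by
  have key (j : ℕ) : (fun x : K => x ^ p)^[j] b = b ^ p ^ j := by
    rw [pow_iterate]
  have h1 : Function.IsPeriodicPt (fun x : K => x ^ p) n b := (key n).trans hn
  have h2 : Function.IsPeriodicPt (fun x : K => x ^ p) k b := (key k).trans hk
  exact (key _).symm.trans (h1.gcd h2)

/-- If `P ∘ S = X ^ M - X`, then the zeros of `P` are the `S`-images of the zeros of
`X ^ M - X`. -/
lemma zeros_eq_image_of_comp_eq {K : Type*} [Field K] [IsAlgClosed K] {P S : K[X]} {M : ℕ}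
    (hM : 1 < M) (h : P.comp S = X ^ M - X) :
    {x : K | P.eval x = 0} = (fun x => S.eval x) '' {x : K | x ^ M = x} := by
  have heval (z : K) : P.eval (S.eval z) = z ^ M - z := by
    rw [← eval_comp, h]; simp
  have hS : S.natDegree ≠ 0 := by
    intro h0
    have e := congrArg natDegree h
    rw [natDegree_comp, h0, mul_zero, FiniteField.X_pow_card_sub_X_natDegree_eq K hM] at e
    omega
  ext y
  constructor
  · intro hy
    obtain ⟨z, rfl⟩ := IsAlgClosed.eval_surjective hS y
    exact ⟨z, sub_eq_zero.1 ((heval z).symm.trans hy), rfl⟩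
  · rintro ⟨z, hz, rfl⟩
    exact (heval z).trans (sub_eq_zero.2 hz)

lemma iterate_iterateFrobenius {R : Type*} [CommSemiring R] {p : ℕ} [ExpChar R p] (k j : ℕ) (x : R) :
    (iterateFrobenius R p k)^[j] x = x ^ (p ^ k) ^ j := by
  have : (iterateFrobenius R p k : R → R) = fun x => x ^ p ^ k := by
    ext x; exact iterateFrobenius_def ..
  rw [this, pow_iterate]

section Composition

variable {K : Type*} [Field K] {p : ℕ} [Fact p.Prime] [CharP K p]

/-- `(τ² + τ + a) ∘ G = τ ^ m + a c_{m-1}^q`, where `τ` is the `q`-power map. -/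
lemma twisted_quadratic_comp (k : ℕ) {a : K} {c : ℕ → K} (h0 : c 0 = 0) (h1 : c 1 = 1)
    (hc : ∀ r, c (r + 2) = -c (r + 1) ^ p ^ k - a ^ p ^ k * c r ^ (p ^ k) ^ 2)
    {M : ℕ} (ham : a ^ (p ^ k) ^ (M + 1) = a) (hcM : c (M + 1) = 0) :
    (X ^ (p ^ k) ^ 2 + X ^ p ^ k + C a * X : K[X]).comp
      (∑ j ∈ Finset.range M, C (c (M - j) ^ (p ^ k) ^ (j + 1)) * X ^ (p ^ k) ^ j) =
    X ^ (p ^ k) ^ (M + 1) - C (-a * c M ^ p ^ k) * X := by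
  set φ := iterateFrobenius K p k
  set ψ := iterateFrobenius K[X] p k
  have hφ (x : K) : x ^ p ^ k = φ x := (iterateFrobenius_def ..).symm
  have hψ (x : K[X]) : x ^ p ^ k = ψ x := (iterateFrobenius_def ..).symm
  have hφj (j : ℕ) (x : K) : x ^ (p ^ k) ^ j = φ^[j] x := (iterate_iterateFrobenius ..).symm
  have hψj (j : ℕ) (x : K[X]) : x ^ (p ^ k) ^ j = ψ^[j] x := (iterate_iterateFrobenius ..).symm
  have hψC (x : K) : ψ (C x) = C (φ x) := by rw [← hφ, ← hψ, C_pow]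
  simp only [add_comp, mul_comp, X_comp, C_comp, pow_comp]
  simp only [hφj, hψj, hφ, hψ] at hc ham ⊢
  simp only [Function.iterate_succ_apply', Function.iterate_zero_apply] at hc
  have hrel := fun j (hj : j + 2 ≤ M + 1) => iterate_coeff_relation φ h0 h1 hc ham hj
  set g : ℕ → K := fun j => φ^[j] (c (M + 1 - j)) with hg
  have hsum : ∑ j ∈ Finset.range M, C (φ^[j + 1] (c (M - j))) * ψ^[j] X =
      ∑ j ∈ Finset.range M, C (g (j + 1)) * ψ^[j] X := by
    simp only [hg, Nat.add_sub_add_right]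
  have hg0 : g 0 = 0 := by simp [hg, hcM]
  have hg1 : g 1 = φ (c M) := by simp [hg]
  have hgM : g M = 1 := by simp [hg, h1]
  have hgM1 : g (M + 1) = 0 := by simp [hg, h0]
  rw [hsum]
  have t1 := Finset.sum_range_sub (fun j => C (φ (φ (g j))) * ψ^[j + 1] (X : K[X])) M
  have t2 := Finset.sum_range_sub (fun j => C (g (j + 1)) * ψ^[j] (X : K[X])) M
  simp only [hg0, hg1, hgM, hgM1, zero_add, map_zero, map_one, zero_mul, one_mul, sub_zero,
    zero_sub, Function.iterate_zero_apply] at t1 t2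
  simp only [Function.iterate_succ_apply', Function.iterate_zero_apply, map_sum, map_mul, hψC,
    Finset.mul_sum, ← Finset.sum_add_distrib] at t1 t2 ⊢
  rw [C_neg, show -C a * C (φ (c M)) * X = C a * -(C (φ (c M)) * X) by ring, ← t1, ← t2, Finset.mul_sum, ← Finset.sum_sub_distrib]
  refine Finset.sum_congr rfl fun j hj => ?_
  have e := congrArg C (hrel j (by have := Finset.mem_range.1 hj; omega))
  change C (φ (φ (g j)) + φ (g (j + 1)) + a * g (j + 2)) = C 0 at e
  simp only [C_add, C_mul, C_0] at e
  linear_combination (ψ (ψ^[j] X)) * e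

variable (s : ℕ) {b : K} (e : ℕ)

lemma twisted_geom_sum_comp (hb : b ^ p ^ s = b) :
    (∑ i ∈ Finset.range e, C (b ^ (e - 1 - i)) * X ^ (p ^ s) ^ i : K[X]).comp
      (X ^ p ^ s - C b * X) = X ^ (p ^ s) ^ e - C (b ^ e) * X := by
  have t := Finset.sum_range_sub (fun i => C (b ^ (e - i)) * (X : K[X]) ^ (p ^ s) ^ i) e
  simp only [Nat.sub_self, pow_zero, C_1, one_mul, pow_one, Nat.sub_zero] at t
  rw [← t, sum_comp]
  refine Finset.sum_congr rfl fun i hi => ?_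
  have hbi : b ^ (p ^ s) ^ i = b := by
    rw [← congrFun (pow_iterate (p ^ s) i) b]
    exact Function.iterate_fixed hb i
  have hei : e - i = e - 1 - i + 1 := by have := Finset.mem_range.1 hi; omega
  simp only [mul_comp, X_comp, C_comp, pow_comp]
  rw [← pow_mul p s i, sub_pow_expChar_pow, mul_pow, ← C_pow, pow_mul p s i, hbi, hei,
    show e - (i + 1) = e - 1 - i by omega, ← pow_mul, ← pow_succ', pow_succ b, C_mul]
  ring

lemma comp_twisted_geom_sum (hb : b ^ p ^ s = b) :
    (X ^ p ^ s - C b * X : K[X]).comp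
      (∑ i ∈ Finset.range e, C (b ^ (e - 1 - i)) * X ^ (p ^ s) ^ i) =
      X ^ (p ^ s) ^ e - C (b ^ e) * X := by
  have t := Finset.sum_range_sub (fun i => C (b ^ (e - i)) * (X : K[X]) ^ (p ^ s) ^ i) e
  simp only [Nat.sub_self, pow_zero, C_1, one_mul, pow_one, Nat.sub_zero] at t
  simp only [sub_comp, mul_comp, X_comp, C_comp, pow_comp]
  rw [← t, sum_pow_char_pow, Finset.mul_sum, ← Finset.sum_sub_distrib]
  refine Finset.sum_congr rfl fun i hi => ?_
  have hei : e - i = e - 1 - i + 1 := by have := Finset.mem_range.1 hi; omega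
  rw [mul_pow, ← C_pow, ← pow_mul b, mul_comm _ (p ^ s), pow_mul b, hb, hei,
    show e - (i + 1) = e - 1 - i by omega, ← pow_mul, ← pow_succ, pow_succ b, C_mul]
  ring

end Composition

theorem stmt_13 (p k n : ℕ) [Fact p.Prime] (hk : 1 ≤ k) (hn : 1 ≤ n)
    (d m q Q N : ℕ) (hd : d = Nat.gcd n k) (hm : m = n / d)
    (hq : q = p ^ k) (hQ : Q = p ^ n) (hN : N = m * (p ^ d - 1))
    (A : ℕ → Polynomial (ZMod p)) (hA1 : A 1 = 1) (hA2 : A 2 = -1)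
    (hA : ∀ r : ℕ, 1 ≤ r → A (r + 2) = -(A (r + 1)) ^ q - X ^ q * A r ^ q ^ 2)
    (a : AlgebraicClosure (ZMod p)) (haQ : a ^ Q = a) (ha0 : a ≠ 0)
    (B : ℕ → AlgebraicClosure (ZMod p)) (hB1 : B 1 = 0)
    (hB : ∀ r : ℕ, 1 ≤ r → B (r + 1) = -a * (aeval a (A r)) ^ q)
    (hma : aeval a (A m) = 0)
    (La F1 G1 G2 : Polynomial (AlgebraicClosure (ZMod p)))
    (hLa : La = X ^ q ^ 2 + X ^ q + C a * X)
    (hF1 : F1 = X ^ q ^ m - C (B m) * X)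
    (hG1 : G1 = ∑ i ∈ Finset.Icc 1 (m - 1),
        C ((aeval a (A (m - i))) ^ q ^ i) * X ^ q ^ (i - 1))
    (hG2 : G2 = ∑ i ∈ Finset.range (p ^ d - 1),
        C (B m ^ (p ^ d - 2 - i)) * X ^ q ^ (m * i)) :
    ((X : Polynomial (AlgebraicClosure (ZMod p))) ^ q ^ N - X = G2.comp F1 ∧
      G2.comp F1 = F1.comp G2 ∧ F1.comp G2 = La.comp (G1.comp G2)) ∧
    {x : AlgebraicClosure (ZMod p) | F1.eval x = 0} =
      (fun x => G2.eval x) '' {x : AlgebraicClosure (ZMod p) | x ^ q ^ N = x} ∧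
    {x : AlgebraicClosure (ZMod p) | La.eval x = 0} =
      (fun x => G1.eval x) ''
        ((fun x => G2.eval x) '' {x : AlgebraicClosure (ZMod p) | x ^ q ^ N = x}) := by
  have hp := (Fact.out : p.Prime)
  have hdpos : 0 < d := hd ▸ Nat.gcd_pos_of_pos_left k hn
  have hdn : d ∣ n := hd ▸ Nat.gcd_dvd_left n k
  have hdk : d ∣ k := hd ▸ Nat.gcd_dvd_right n k
  have hmpos : 0 < m := hm ▸ Nat.div_pos (Nat.le_of_dvd hn hdn) hdpos
  have hpd : 2 ≤ p ^ d := hp.two_le.trans (Nat.le_self_pow hdpos.ne' p)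
  have hq2 : 2 ≤ q := hq ▸ hp.two_le.trans (Nat.le_self_pow (by omega) p)
  have hNpos : N ≠ 0 := hN ▸ Nat.mul_ne_zero hmpos.ne' (by omega)
  have hqN : 1 < q ^ N := Nat.one_lt_pow hNpos hq2
  obtain ⟨M, rfl⟩ : ∃ M, m = M + 1 := ⟨m - 1, by omega⟩
  have hM : 1 ≤ M := by
    rcases Nat.eq_zero_or_pos M with rfl | h
    · simp [hA1] at hma
    · exact h
  have ham : a ^ q ^ (M + 1) = a := by
    obtain ⟨t, ht⟩ := hdk
    obtain ⟨u, hu⟩ := hdn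
    have hmu : M + 1 = u := by rw [hm, hu, Nat.mul_div_cancel_left _ hdpos]
    have hexp : q ^ (M + 1) = Q ^ t := by
      rw [hq, hQ, ← pow_mul, ← pow_mul, ht, hmu, hu]; ring_nf
    rw [hexp, ← congrFun (pow_iterate Q t) a]
    exact Function.iterate_fixed haQ t
  set c : ℕ → AlgebraicClosure (ZMod p) := fun r => if r = 0 then 0 else aeval a (A r) with hcdef
  have hcA {r : ℕ} (hr : 1 ≤ r) : aeval a (A r) = c r := by
    simp [hcdef, Nat.one_le_iff_ne_zero.1 hr]
  have h0 : c 0 = 0 := by simp [hcdef]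
  have h1 : c 1 = 1 := by simp [hcdef, hA1]
  have hc (r : ℕ) : c (r + 2) = -c (r + 1) ^ q - a ^ q * c r ^ q ^ 2 := by
    rcases Nat.eq_zero_or_pos r with rfl | hr
    · rw [zero_add, zero_add, h0, h1, zero_pow (by positivity), ← hcA (by omega), hA2]
      simp
    · rw [← hcA hr, ← hcA (by omega), ← hcA (by omega), hA r hr]
      simp
  have hcM : c (M + 1) = 0 := by rw [← hcA (by omega), hma]
  have hcQ (r : ℕ) : c r ^ Q = c r := by
    have hpair : c r ^ Q = c r ∧ c (r + 1) ^ Q = c (r + 1) := by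
      induction r with
      | zero => simp [h0, h1, hQ, hp.ne_zero]
      | succ r ih =>
        refine ⟨ih.2, ?_⟩
        have hφ (x : AlgebraicClosure (ZMod p)) : x ^ Q = iterateFrobenius _ p n x := by
          rw [hQ, iterateFrobenius_def]
        rw [hφ] at ih haQ ⊢
        rw [hφ] at ih
        rw [hc r]
        simp only [map_sub, map_neg, map_mul, map_pow, ih.1, ih.2, haQ]
    exact hpair.1
  have hBM : B (M + 1) = -a * c M ^ q := by rw [hB M hM, hcA hM]
  set b := B (M + 1)
  obtain ⟨x, hx0, hx⟩ := exists_ne_zero_twisted_root hq2 ha0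
  obtain ⟨hbq, hb0⟩ : b ^ q = b ∧ b ≠ 0 := by
    set φ := iterateFrobenius (AlgebraicClosure (ZMod p)) p k
    have hφ (y : AlgebraicClosure (ZMod p)) : y ^ q = φ y := by
      rw [hq]; exact (iterateFrobenius_def ..).symm
    have hφj (j : ℕ) (y : AlgebraicClosure (ZMod p)) : y ^ q ^ j = φ^[j] y := by
      rw [hq]; exact (iterate_iterateFrobenius ..).symm
    simp only [hφj, hφ] at hc hx ham hBM ⊢
    rw [hBM]
    exact twisted_eigenvalue_fixed φ h0 h1 hc ham hcM hx0 hx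
  have hbQ : b ^ Q = b := by
    have hneg : (-a) ^ Q = -a := by
      rw [hQ, ← iterateFrobenius_def, map_neg, iterateFrobenius_def, ← hQ, haQ]
    rw [hBM, mul_pow, pow_right_comm, hcQ, hneg]
  have hbd : b ^ (p ^ d - 1) = 1 := by
    have e : b ^ p ^ d = b := hd ▸ pow_prime_pow_gcd_eq (hq ▸ hbq) (hQ ▸ hbQ)
    have e2 : b ^ (p ^ d - 1) * b = 1 * b := by
      rw [← pow_succ, Nat.sub_add_cancel (by omega), e, one_mul]
    exact mul_right_cancel₀ hb0 e2
  have hbqm : b ^ q ^ (M + 1) = b := by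
    rw [← congrFun (pow_iterate q (M + 1)) b]
    exact Function.iterate_fixed hbq (M + 1)
  have hLG : La.comp G1 = F1 := by
    have hsum : G1 = ∑ j ∈ Finset.range M, C (c (M - j) ^ q ^ (j + 1)) * X ^ q ^ j := by
      rw [hG1, Nat.add_sub_cancel, ← Finset.Ico_add_one_right_eq_Icc,
        Finset.sum_Ico_eq_sum_range, Nat.add_sub_cancel]
      refine Finset.sum_congr rfl fun j hj => ?_
      have := Finset.mem_range.1 hj
      rw [hcA (by omega), show M + 1 - (1 + j) = M - j by omega, Nat.add_sub_cancel_left,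
        add_comm 1 j]
    rw [hsum, hLa, hF1, hBM]
    subst hq
    exact twisted_quadratic_comp k h0 h1 hc ham hcM
  have hqm : q ^ (M + 1) = p ^ (k * (M + 1)) := by rw [hq, ← pow_mul]
  have hG2' : G2 = ∑ i ∈ Finset.range (p ^ d - 1),
      C (b ^ (p ^ d - 1 - 1 - i)) * X ^ (p ^ (k * (M + 1))) ^ i := by
    rw [hG2]
    refine Finset.sum_congr rfl fun i _ => ?_
    rw [pow_mul, hqm, Nat.sub_sub (p ^ d) 1 1]
  have hpN : (p ^ (k * (M + 1))) ^ (p ^ d - 1) = q ^ N := by rw [← hqm, hN, pow_mul]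
  have hGF : G2.comp F1 = X ^ q ^ N - X := by
    rw [hG2', hF1, hqm, twisted_geom_sum_comp _ _ (hqm ▸ hbqm), hbd, hpN, C_1, one_mul]
  have hFG : F1.comp G2 = X ^ q ^ N - X := by
    rw [hG2', hF1, hqm, comp_twisted_geom_sum _ _ (hqm ▸ hbqm), hbd, hpN, C_1, one_mul]
  have hLGG : La.comp (G1.comp G2) = X ^ q ^ N - X := by
    rw [← comp_assoc, hLG, hFG]
  refine ⟨⟨hGF.symm, hGF.trans hFG.symm, hFG.trans hLGG.symm⟩,
    zeros_eq_image_of_comp_eq hqN hFG, ?_⟩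
  rw [zeros_eq_image_of_comp_eq hqN hLGG, Set.image_image]
  simp only [eval_comp]
end

section
/- Let a ∈ GF(Q)* with A_m(a) = 0 and let x_0 ∈ GF(Q) satisfy x_0^{q+1} + x_0 + a = 0 (so x_0 ≠ 0). Then: (1) x_0^2/a is a (q-1)-th power of an element of GF(Q); (2) for any β ∈ GF(Q) with β^{q-1} = x_0^2/a, the equation w^q - w + 1/(β·x_0) = 0 has exactly p^d solutions w in GF(Q); (3) for any such solution w_0 ∈ GF(Q), the set of all zeros of P_a(X) in GF(Q) is {x_0} ∪ { (w_0 + α)^{q-1}·x_0 : α ∈ GF(p^d) }, and this set has exactly p^d + 1 elements. -/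
open Polynomial

section FrobeniusOrbits

variable {L : Type*} [Field L] {p : ℕ} [Fact p.Prime] [CharP L p]

/-- The elements fixed by the `j`-th power of Frobenius form a set with `p ^ j` elements. -/
theorem ncard_pow_eq_self [IsAlgClosed L] {j : ℕ} (hj : j ≠ 0) :
    {x : L | x ^ p ^ j = x}.ncard = p ^ j := by
  have hp : 1 < p ^ j := Nat.one_lt_pow hj (Fact.out : p.Prime).one_lt
  have hdeg : (X ^ p ^ j - X : L[X]).natDegree = p ^ j :=
    FiniteField.X_pow_card_sub_X_natDegree_eq L hp
  have hne : (X ^ p ^ j - X : L[X]) ≠ 0 := FiniteField.X_pow_card_sub_X_ne_zero L hp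
  have hset : {x : L | x ^ p ^ j = x} = (X ^ p ^ j - X : L[X]).rootSet L := by
    ext x
    simp [mem_rootSet, hne, sub_eq_zero]
  rw [hset, ← Nat.card_coe_set_eq, Nat.card_eq_fintype_card,
    card_rootSet_eq_natDegree (galois_poly_separable p _ (dvd_pow_self p hj))
      (IsAlgClosed.splits _), hdeg]

theorem isPeriodicPt_frobenius_iff {j : ℕ} {x : L} :
    Function.IsPeriodicPt (frobenius L p) j x ↔ x ^ p ^ j = x := by
  rw [Function.IsPeriodicPt, Function.IsFixedPt, iterate_frobenius]

theorem pow_eq_self_gcd_iff {n k : ℕ} {x : L} :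
    x ^ p ^ Nat.gcd n k = x ↔ x ^ p ^ n = x ∧ x ^ p ^ k = x := by
  simp only [← isPeriodicPt_frobenius_iff]
  exact ⟨fun h => ⟨h.trans_dvd (Nat.gcd_dvd_left n k), h.trans_dvd (Nat.gcd_dvd_right n k)⟩,
    fun h => h.1.gcd h.2⟩

theorem pow_char_pow_eq_mod {n j : ℕ} {x : L} (hx : x ^ p ^ n = x) :
    x ^ p ^ j = x ^ p ^ (j % n) := by
  rw [← iterate_frobenius, ← iterate_frobenius]
  exact ((isPeriodicPt_frobenius_iff.2 hx).iterate_mod_apply j).symm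

/-- Independence of the first `n / gcd n k` powers of `x ↦ x ^ p ^ k` on the field with `p ^ n`
elements. -/
theorem exists_sum_mul_pow_ne_zero [IsAlgClosed L] {n k : ℕ} (hn : 1 ≤ n) (M : ℕ → L)
    (hM : M 0 ≠ 0) :
    ∃ θ : L, θ ^ p ^ n = θ ∧
      ∑ i ∈ Finset.range (n / Nat.gcd n k), M i * θ ^ (p ^ k) ^ i ≠ 0 := by
  by_contra! h
  have hp : 1 < p := (Fact.out : p.Prime).one_lt
  set m := n / Nat.gcd n k with hm
  have hd : 0 < Nat.gcd n k := Nat.gcd_pos_of_pos_left k hn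
  have hm0 : 0 < m := Nat.div_pos (Nat.le_of_dvd hn (Nat.gcd_dvd_left n k)) hd
  let f : L[X] := ∑ i ∈ Finset.range m, C (M i) * X ^ p ^ ((k * i) % n)
  have hcoeff : f.coeff 1 = M 0 := by
    simp only [f, finsetSum_coeff, coeff_C_mul, coeff_X_pow]
    rw [Finset.sum_eq_single 0]
    · simp
    · intro i hi hi0
      rw [if_neg, mul_zero]
      intro h1
      have h2 : k * i % n = 0 := by
        by_contra h3
        exact (Nat.one_lt_pow h3 hp).ne h1
      have h4 : n / Nat.gcd n k ∣ i :=
        (Nat.coprime_div_gcd_div_gcd hd).dvd_of_dvd_mul_left <| by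
          refine Nat.dvd_of_mul_dvd_mul_left hd ?_
          rw [← mul_assoc, Nat.mul_div_cancel' (Nat.gcd_dvd_left n k),
            Nat.mul_div_cancel' (Nat.gcd_dvd_right n k)]
          exact Nat.dvd_of_mod_eq_zero h2
      exact absurd (Nat.le_of_dvd (Nat.pos_of_ne_zero hi0) h4) (by simpa using hi)
    · intro h0
      exact absurd (Finset.mem_range.2 hm0) h0
  have hf : f ≠ 0 := by
    intro hf
    rw [hf, coeff_zero] at hcoeff
    exact hM hcoeff.symm
  have hdeg : f.natDegree ≤ p ^ (n - 1) := by
    refine natDegree_sum_le_of_forall_le _ _ fun i _ => (natDegree_C_mul_X_pow_le _ _).trans ?_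
    exact Nat.pow_le_pow_right hp.le (Nat.le_sub_one_of_lt (Nat.mod_lt _ hn))
  have hsub : {x : L | x ^ p ^ n = x} ⊆ f.rootSet L := by
    intro θ hθ
    rw [mem_rootSet]
    refine ⟨hf, ?_⟩
    rw [← h θ hθ]
    simp only [f, map_sum, map_mul, map_pow, aeval_X, aeval_C, Algebra.algebraMap_self,
      RingHom.id_apply]
    refine Finset.sum_congr rfl fun i _ => ?_
    rw [← pow_mul, pow_char_pow_eq_mod (j := k * i) hθ]
  have hle := Set.ncard_le_ncard hsub (rootSet_finite f L)
  rw [ncard_pow_eq_self (by omega)] at hle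
  have := hle.trans ((ncard_rootSet_le f L).trans hdeg)
  exact absurd this (not_le.2 (Nat.pow_lt_pow_right hp (by omega)))

theorem pow_eq_self_of_recurrence {n k : ℕ} {b c : L} (hb : b ^ p ^ n = b) (hc : c ^ p ^ n = c)
    {T : ℕ → L} (hT0 : T 0 ^ p ^ n = T 0) (hT : ∀ i, T (i + 1) = b + c * T i ^ p ^ k) (i : ℕ) :
    T i ^ p ^ n = T i := by
  induction i with
  | zero => exact hT0
  | succ i ih => rw [hT, add_pow_char_pow, mul_pow, pow_right_comm, hb, hc, ih]

theorem pow_pow_div_gcd {n k : ℕ} {x : L} (hx : x ^ p ^ n = x) :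
    x ^ (p ^ k) ^ (n / Nat.gcd n k) = x := by
  rw [← pow_mul, ← isPeriodicPt_frobenius_iff]
  refine (isPeriodicPt_frobenius_iff.2 hx).trans_dvd ?_
  rw [← Nat.mul_div_assoc k (Nat.gcd_dvd_left n k), mul_comm,
    Nat.mul_div_assoc n (Nat.gcd_dvd_right n k)]
  exact dvd_mul_right _ _

/-- Multiplicative Hilbert 90: `M i` is the partial norm `∏_{j < i} c ^ (p ^ k) ^ j`. -/
theorem exists_mul_pow_eq_self [IsAlgClosed L] {n k : ℕ} (hn : 1 ≤ n) {c : L}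
    (hc : c ^ p ^ n = c) {M : ℕ → L} (hM0 : M 0 = 1) (hM : ∀ i, M (i + 1) = c * M i ^ p ^ k)
    (hMm : M (n / Nat.gcd n k) = 1) :
    ∃ y : L, y ^ p ^ n = y ∧ y ≠ 0 ∧ c * y ^ p ^ k = y := by
  have hpos : p ^ n ≠ 0 := pow_ne_zero _ (Fact.out : p.Prime).ne_zero
  obtain ⟨θ, hθ, hne⟩ := exists_sum_mul_pow_ne_zero (p := p) (k := k) hn M (by simp [hM0])
  have hMn : ∀ i, M i ^ p ^ n = M i :=
    pow_eq_self_of_recurrence (b := 0) (k := k) (zero_pow hpos) hc (by simp [hM0])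
      (by simpa using hM)
  refine ⟨_, ?_, hne, ?_⟩
  · rw [sum_pow_char_pow]
    refine Finset.sum_congr rfl fun i _ => ?_
    rw [mul_pow, pow_right_comm, hθ, hMn]
  · have hshift := Finset.sum_range_succ' (fun i => M i * θ ^ (p ^ k) ^ i) (n / Nat.gcd n k)
    rw [Finset.sum_range_succ, pow_pow_div_gcd hθ, hMm, hM0, pow_zero, pow_one,
      add_left_inj] at hshift
    conv_rhs => rw [hshift]
    rw [sum_pow_char_pow, Finset.mul_sum]
    refine Finset.sum_congr rfl fun i _ => ?_
    rw [mul_pow, ← pow_mul, ← pow_succ, hM, mul_assoc]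

/-- Additive Hilbert 90: `S i` is the partial trace `∑_{j < i} v ^ (p ^ k) ^ j`. -/
theorem exists_pow_sub_add_eq_zero [IsAlgClosed L] {n k : ℕ} (hn : 1 ≤ n) {v : L}
    (hv : v ^ p ^ n = v) {S : ℕ → L} (hS0 : S 0 = 0) (hS : ∀ i, S (i + 1) = v + S i ^ p ^ k)
    (hSm : S (n / Nat.gcd n k) = 0) :
    ∃ w : L, w ^ p ^ n = w ∧ w ^ p ^ k - w + v = 0 := by
  have hpos : p ^ n ≠ 0 := pow_ne_zero _ (Fact.out : p.Prime).ne_zero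
  obtain ⟨θ, hθ, hne⟩ := exists_sum_mul_pow_ne_zero (p := p) (k := k) hn (fun _ => (1 : L))
    one_ne_zero
  simp only [one_mul] at hne
  have hSn : ∀ i, S i ^ p ^ n = S i :=
    pow_eq_self_of_recurrence (c := 1) (k := k) hv (by simp) (by rw [hS0, zero_pow hpos])
      (by simpa using hS)
  set m := n / Nat.gcd n k
  set t := ∑ i ∈ Finset.range m, θ ^ (p ^ k) ^ i with ht
  set s := ∑ i ∈ Finset.range m, S i * θ ^ (p ^ k) ^ i with hs
  have hθm : θ ^ (p ^ k) ^ m = θ := pow_pow_div_gcd hθ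
  have htn : t ^ p ^ n = t := by
    rw [ht, sum_pow_char_pow]
    exact Finset.sum_congr rfl fun i _ => by rw [pow_right_comm, hθ]
  have hsn : s ^ p ^ n = s := by
    rw [hs, sum_pow_char_pow]
    exact Finset.sum_congr rfl fun i _ => by rw [mul_pow, pow_right_comm, hθ, hSn]
  have htk' : t = ∑ i ∈ Finset.range m, θ ^ (p ^ k) ^ (i + 1) := by
    have h := Finset.sum_range_succ' (fun i => θ ^ (p ^ k) ^ i) m
    rwa [Finset.sum_range_succ, hθm, pow_zero, pow_one, add_left_inj] at h
  have htk : t ^ p ^ k = t := by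
    conv_rhs => rw [htk']
    rw [ht, sum_pow_char_pow]
    exact Finset.sum_congr rfl fun i _ => by rw [← pow_mul, ← pow_succ]
  have hsk : s = v * t + s ^ p ^ k := by
    have h := Finset.sum_range_succ' (fun i => S i * θ ^ (p ^ k) ^ i) m
    rw [Finset.sum_range_succ, hSm, hS0, zero_mul, zero_mul, add_zero, add_zero, ← hs] at h
    have hspow : s ^ p ^ k = ∑ i ∈ Finset.range m, S i ^ p ^ k * θ ^ (p ^ k) ^ (i + 1) := by
      rw [hs, sum_pow_char_pow]
      exact Finset.sum_congr rfl fun i _ => by rw [mul_pow, ← pow_mul, ← pow_succ]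
    rw [hspow, h, htk', Finset.mul_sum, ← Finset.sum_add_distrib]
    refine Finset.sum_congr rfl fun i _ => ?_
    rw [hS, add_mul]
  refine ⟨s / t, by rw [div_pow, hsn, htn], ?_⟩
  rw [div_pow, htk]
  field_simp
  linear_combination -hsk

end FrobeniusOrbits

section ProjectivePolynomial

theorem pow_sub_one_mul_eq_sub {L : Type*} [Field L] {p : ℕ} [Fact p.Prime] {k : ℕ}
    {x₀ β w : L} (hx₀ : x₀ ≠ 0) (hβ : β ≠ 0) (hw : w ≠ 0)
    (hwq : w ^ p ^ k - w + 1 / (β * x₀) = 0) :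
    w ^ (p ^ k - 1) * x₀ = x₀ - 1 / (β * w) := by
  have hpos : p ^ k ≠ 0 := pow_ne_zero _ (Fact.out : p.Prime).ne_zero
  have h1 : w ^ (p ^ k - 1) * w = w ^ p ^ k := pow_sub_one_mul hpos w
  have h2 : w ^ (p ^ k - 1) = (w - 1 / (β * x₀)) / w := by
    rw [eq_div_iff hw, h1]
    linear_combination hwq
  rw [h2]
  field_simp

variable {L : Type*} [Field L] {p : ℕ} [Fact p.Prime] [CharP L p]

/-- A sequence satisfying the recurrence of the polynomials `A_r`, evaluated at `a`, is the
product of the partial norms of a zero `x` and an affine orbit starting at `0`. -/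
theorem recurrence_eq_mul {k : ℕ} {a x : L} (hx0 : x ≠ 0)
    (hx : x ^ (p ^ k + 1) + x + a = 0) {B z T : ℕ → L} (hB1 : B 1 = 1) (hB2 : B 2 = -1)
    (hB : ∀ r, 1 ≤ r → B (r + 2) = -B (r + 1) ^ p ^ k - a ^ p ^ k * B r ^ (p ^ k) ^ 2)
    (hz0 : z 0 = 1) (hz : ∀ i, z (i + 1) = x * z i ^ p ^ k)
    (hT0 : T 0 = 0) (hT : ∀ i, T (i + 1) = 1 / x + a / x ^ 2 * T i ^ p ^ k) (r : ℕ) :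
    B (r + 1) = z (r + 1) * T (r + 1) := by
  have hpos : p ^ k ≠ 0 := pow_ne_zero _ (Fact.out : p.Prime).ne_zero
  have hy0 : x ^ p ^ k ≠ 0 := pow_ne_zero _ hx0
  have hxy : x * x ^ p ^ k + x + a = 0 := by rw [← hx, pow_succ, mul_comm]
  have hz1 (i : ℕ) : z (i + 1) ^ p ^ k = x ^ p ^ k * z i ^ (p ^ k) ^ 2 := by
    rw [hz, mul_pow, ← pow_mul, ← sq]
  have hT1 (i : ℕ) : T (i + 1) ^ p ^ k =
      1 / x ^ p ^ k + a ^ p ^ k / (x ^ p ^ k) ^ 2 * T i ^ (p ^ k) ^ 2 := by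
    rw [hT, add_pow_char_pow, mul_pow, div_pow, div_pow, one_pow, ← pow_mul (T i), ← sq,
      pow_right_comm]
  induction r using Nat.twoStepInduction with
  | zero =>
    rw [hz, hT, hz0, hT0, zero_add, hB1, one_pow, zero_pow hpos]
    field_simp
    simp
  | one =>
    rw [hz, hT, hz1, hT1, hz0, hT0, one_pow, zero_pow (pow_ne_zero 2 hpos), hB2]
    generalize x ^ p ^ k = y at *
    field_simp
    linear_combination -y * hxy
  | more r ih1 ih2 =>
    rw [hB (r + 1) (by omega), ih1, ih2, hz (r + 1 + 1), hT (r + 1 + 1), mul_pow, mul_pow, hz1,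
      hT1]
    generalize x ^ p ^ k = y at *
    generalize z (r + 1) ^ (p ^ k) ^ 2 = Z
    generalize T (r + 1) ^ (p ^ k) ^ 2 = D
    generalize a ^ p ^ k = b
    field_simp
    linear_combination (-Z * y - Z * b * D) * hxy

variable {k : ℕ} {a x₀ β w x : L}

theorem partial_norm_eq_one {n : ℕ} {b c : L} (hb0 : b ≠ 0) (hb : b ^ p ^ n = b)
    {M T : ℕ → L} (hM0 : M 0 = 1) (hM : ∀ i, M (i + 1) = c * M i ^ p ^ k)
    (hT0 : T 0 = 0) (hT : ∀ i, T (i + 1) = b + c * T i ^ p ^ k)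
    (hTm : T (n / Nat.gcd n k) = 0) : M (n / Nat.gcd n k) = 1 := by
  have hpos : p ^ k ≠ 0 := pow_ne_zero _ (Fact.out : p.Prime).ne_zero
  have hstep (i : ℕ) : T (i + 1) = T i + M i * b ^ (p ^ k) ^ i := by
    induction i with
    | zero => simp [hT, hT0, hM0, zero_pow hpos]
    | succ i ih =>
      rw [hT (i + 1), ih, add_pow_char_pow, mul_pow, ← pow_mul b, ← pow_succ, hM, ← ih, hT i]
      ring
  have h := hstep (n / Nat.gcd n k)
  rw [hT, hTm, zero_pow hpos, pow_pow_div_gcd hb, mul_zero, add_zero, zero_add] at h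
  exact mul_right_cancel₀ hb0 (by rw [← h, one_mul])

theorem sub_one_div_isZero (ha : a ≠ 0) (hx₀ : x₀ ≠ 0) (hβ : β ≠ 0)
    (hβq : β ^ p ^ k * a = β * x₀ ^ 2) (hx₀q : x₀ ^ p ^ k * x₀ + x₀ + a = 0) (hw : w ≠ 0)
    (hwq : w ^ p ^ k - w + 1 / (β * x₀) = 0) :
    (x₀ - 1 / (β * w)) ^ p ^ k * (x₀ - 1 / (β * w)) + (x₀ - 1 / (β * w)) + a = 0 := by
  have hw' : w ^ p ^ k = (w * β * x₀ - 1) / (β * x₀) := by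
    field_simp at hwq ⊢
    linear_combination hwq
  have hne : w * β * x₀ - 1 ≠ 0 := fun h0 =>
    pow_ne_zero (p ^ k) hw (by rw [hw', h0, zero_div])
  have hβ' : β ^ p ^ k = β * x₀ ^ 2 / a := by rw [eq_div_iff ha, hβq]
  have hx' : x₀ ^ p ^ k = -(x₀ + a) / x₀ := by
    rw [eq_div_iff hx₀]
    linear_combination hx₀q
  rw [sub_pow_char_pow, div_pow, mul_pow, one_pow, hw', hβ', hx']
  field_simp
  linear_combination -a * mul_inv_cancel₀ hne

theorem one_div_sub_pow_sub_add_eq_zero (ha : a ≠ 0) (hx₀ : x₀ ≠ 0) (hβ : β ≠ 0)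
    (hβq : β ^ p ^ k * a = β * x₀ ^ 2) (hx₀q : x₀ ^ p ^ k * x₀ + x₀ + a = 0)
    (hxq : x ^ p ^ k * x + x + a = 0) (hne : x ≠ x₀) :
    (1 / (β * (x₀ - x))) ^ p ^ k - 1 / (β * (x₀ - x)) + 1 / (β * x₀) = 0 := by
  have hx : x ≠ 0 := by
    rintro rfl
    simp [ha] at hxq
  have hsub : x₀ - x ≠ 0 := sub_ne_zero.2 hne.symm
  have hβ' : β ^ p ^ k = β * x₀ ^ 2 / a := by rw [eq_div_iff ha, hβq]
  have hsub' : x₀ ^ p ^ k - x ^ p ^ k = a * (x₀ - x) / (x * x₀) := by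
    rw [eq_div_iff (mul_ne_zero hx hx₀)]
    linear_combination x * hx₀q - x₀ * hxq
  rw [div_pow, mul_pow, sub_pow_char_pow, one_pow, hβ', hsub']
  field_simp
  ring

end ProjectivePolynomial

theorem stmt_18 (p k n : ℕ) [Fact p.Prime] (hk : 1 ≤ k) (hn : 1 ≤ n)
    (d m q Q : ℕ) (hd : d = Nat.gcd n k) (hm : m = n / d)
    (hq : q = p ^ k) (hQ : Q = p ^ n)
    (A : ℕ → Polynomial (ZMod p)) (hA1 : A 1 = 1) (hA2 : A 2 = -1)
    (hA : ∀ r : ℕ, 1 ≤ r → A (r + 2) = -(A (r + 1)) ^ q - X ^ q * A r ^ q ^ 2)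
    (a : AlgebraicClosure (ZMod p)) (haQ : a ^ Q = a) (ha0 : a ≠ 0)
    (hma : aeval a (A m) = 0)
    (x0 : AlgebraicClosure (ZMod p)) (hx0Q : x0 ^ Q = x0)
    (hx0 : x0 ^ (q + 1) + x0 + a = 0) :
    (∃ c : AlgebraicClosure (ZMod p), c ^ Q = c ∧ c ^ (q - 1) = x0 ^ 2 / a) ∧
    ∀ β : AlgebraicClosure (ZMod p), β ^ Q = β → β ^ (q - 1) = x0 ^ 2 / a →
      ({w : AlgebraicClosure (ZMod p) |
          w ^ Q = w ∧ w ^ q - w + 1 / (β * x0) = 0}.ncard = p ^ d ∧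
       ∀ w0 : AlgebraicClosure (ZMod p), w0 ^ Q = w0 →
         w0 ^ q - w0 + 1 / (β * x0) = 0 →
         ({x : AlgebraicClosure (ZMod p) | x ^ Q = x ∧ x ^ (q + 1) + x + a = 0} =
            insert x0 {x : AlgebraicClosure (ZMod p) |
              ∃ α : AlgebraicClosure (ZMod p), α ^ p ^ d = α ∧
                x = (w0 + α) ^ (q - 1) * x0} ∧
          {x : AlgebraicClosure (ZMod p) |
            x ^ Q = x ∧ x ^ (q + 1) + x + a = 0}.ncard = p ^ d + 1)) := by
  subst hd hm hq hQ
  have hp := (Fact.out : p.Prime)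
  have hpos : p ^ k ≠ 0 := pow_ne_zero _ hp.ne_zero
  have hd0 : Nat.gcd n k ≠ 0 := (Nat.gcd_pos_of_pos_left k hn).ne'
  have hm0 : 0 < n / Nat.gcd n k :=
    Nat.div_pos (Nat.le_of_dvd hn (Nat.gcd_dvd_left n k)) (Nat.pos_of_ne_zero hd0)
  have hx0ne : x0 ≠ 0 := by
    rintro rfl
    simp [ha0] at hx0
  have hx0q : x0 ^ p ^ k * x0 + x0 + a = 0 := by rw [← pow_succ, hx0]
  have hux : (1 / x0) ^ p ^ n = 1 / x0 := by rw [div_pow, one_pow, hx0Q]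
  have hc : (a / x0 ^ 2) ^ p ^ n = a / x0 ^ 2 := by rw [div_pow, pow_right_comm, haQ, hx0Q]
  let T : ℕ → AlgebraicClosure (ZMod p) :=
    Nat.rec 0 fun _ t => 1 / x0 + a / x0 ^ 2 * t ^ p ^ k
  let M : ℕ → AlgebraicClosure (ZMod p) := Nat.rec 1 fun _ t => a / x0 ^ 2 * t ^ p ^ k
  let z : ℕ → AlgebraicClosure (ZMod p) := Nat.rec 1 fun _ t => x0 * t ^ p ^ k
  have hz : ∀ i, z i ≠ 0 := by
    intro i
    induction i with
    | zero => exact one_ne_zero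
    | succ i ih => exact mul_ne_zero hx0ne (pow_ne_zero _ ih)
  have hTm : T (n / Nat.gcd n k) = 0 := by
    have h := recurrence_eq_mul (p := p) (k := k) (B := fun r => aeval a (A r)) (z := z) (T := T)
      hx0ne hx0 (by simp [hA1]) (by simp [hA2]) (fun r hr => by simp [hA r hr]) rfl
      (fun _ => rfl) rfl (fun _ => rfl) (n / Nat.gcd n k - 1)
    rw [Nat.sub_add_cancel hm0] at h
    exact (mul_eq_zero.1 (h.symm.trans hma)).resolve_left (hz _)
  have hMm : M (n / Nat.gcd n k) = 1 :=
    partial_norm_eq_one (p := p) (one_div_ne_zero hx0ne) hux rfl (fun _ => rfl) rfl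
      (fun _ => rfl) hTm
  refine ⟨?_, fun β hβQ hβ => ?_⟩
  · obtain ⟨y, hyQ, hy0, hy⟩ :=
      exists_mul_pow_eq_self (p := p) (k := k) hn hc (M := M) rfl (fun _ => rfl) hMm
    refine ⟨y, hyQ, mul_right_cancel₀ hy0 ?_⟩
    rw [pow_sub_one_mul hpos]
    nth_rewrite 2 [← hy]
    field_simp
  have hβ0 : β ≠ 0 := by
    rintro rfl
    have hone : p ^ k - 1 ≠ 0 := by
      have := Nat.one_lt_pow (Nat.one_le_iff_ne_zero.1 hk) hp.one_lt
      omega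
    rw [zero_pow hone] at hβ
    exact div_ne_zero (pow_ne_zero 2 hx0ne) ha0 hβ.symm
  have hβq : β ^ p ^ k * a = β * x0 ^ 2 := by
    rw [← pow_sub_one_mul hpos, hβ]
    field_simp
  have hv : (1 / (β * x0)) ^ p ^ n = 1 / (β * x0) := by
    rw [div_pow, mul_pow, one_pow, hβQ, hx0Q]
  have hw_ne {w : AlgebraicClosure (ZMod p)} (hw : w ^ p ^ k - w + 1 / (β * x0) = 0) :
      w ≠ 0 := by
    rintro rfl
    simp [zero_pow hpos, hβ0, hx0ne] at hw
  have hsol {w w' : AlgebraicClosure (ZMod p)} (hwn : w ^ p ^ n = w)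
      (hw : w ^ p ^ k - w + 1 / (β * x0) = 0) :
      (w' ^ p ^ n = w' ∧ w' ^ p ^ k - w' + 1 / (β * x0) = 0) ↔
        (w' - w) ^ p ^ Nat.gcd n k = w' - w := by
    rw [pow_eq_self_gcd_iff, sub_pow_char_pow, sub_pow_char_pow, hwn, sub_left_inj]
    refine and_congr_right fun _ => ⟨fun h => ?_, fun h => ?_⟩
    · linear_combination h - hw
    · linear_combination h + hw
  have hfix := ncard_pow_eq_self (L := AlgebraicClosure (ZMod p)) (p := p) hd0
  refine ⟨?_, fun w0 hw0Q hw0 => ?_⟩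
  · have hS : ∀ i, T (i + 1) / β = 1 / (β * x0) + (T i / β) ^ p ^ k := by
      intro i
      change (1 / x0 + a / x0 ^ 2 * T i ^ p ^ k) / β = _
      have hβ' : β ^ p ^ k = β * x0 ^ 2 / a := by rw [eq_div_iff ha0, hβq]
      rw [div_pow, hβ']
      field_simp
    obtain ⟨w, hwQ, hw⟩ := exists_pow_sub_add_eq_zero (p := p) (k := k) hn hv
      (S := fun i => T i / β) (zero_div β) hS (by simp [hTm])
    have himage : {w' : AlgebraicClosure (ZMod p) |
        w' ^ p ^ n = w' ∧ w' ^ p ^ k - w' + 1 / (β * x0) = 0} =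
        (fun α => w + α) '' {α | α ^ p ^ Nat.gcd n k = α} := by
      ext w'
      rw [Set.mem_ofPred_eq, hsol hwQ hw]
      exact ⟨fun h => ⟨w' - w, h, add_sub_cancel w w'⟩,
        by rintro ⟨α, hα, rfl⟩; simpa using hα⟩
    rw [himage, Set.ncard_image_of_injective _ (add_right_injective w), hfix]
  have hsolα {α : AlgebraicClosure (ZMod p)} (hα : α ^ p ^ Nat.gcd n k = α) :
      (w0 + α) ^ p ^ n = w0 + α ∧ (w0 + α) ^ p ^ k - (w0 + α) + 1 / (β * x0) = 0 :=
    (hsol hw0Q hw0).2 (by simpa using hα)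
  have hparam {α : AlgebraicClosure (ZMod p)} (hα : α ^ p ^ Nat.gcd n k = α) :
      (w0 + α) ^ (p ^ k - 1) * x0 = x0 - 1 / (β * (w0 + α)) :=
    pow_sub_one_mul_eq_sub hx0ne hβ0 (hw_ne (hsolα hα).2) (hsolα hα).2
  have hset : {x : AlgebraicClosure (ZMod p) | x ^ p ^ n = x ∧ x ^ (p ^ k + 1) + x + a = 0} =
      insert x0 {x : AlgebraicClosure (ZMod p) |
        ∃ α : AlgebraicClosure (ZMod p), α ^ p ^ Nat.gcd n k = α ∧
          x = (w0 + α) ^ (p ^ k - 1) * x0} := by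
    ext x
    simp only [Set.mem_insert_iff, Set.mem_ofPred_eq]
    constructor
    · rintro ⟨hxQ, hx⟩
      refine or_iff_not_imp_left.2 fun hne => ?_
      have hw := one_div_sub_pow_sub_add_eq_zero ha0 hx0ne hβ0 hβq hx0q (by rw [← pow_succ, hx]) hne
      have hα := (hsol hw0Q hw0).1 ⟨by rw [div_pow, mul_pow, sub_pow_char_pow, one_pow, hβQ, hxQ,
        hx0Q], hw⟩
      refine ⟨_, hα, ?_⟩
      have hsub : x0 - x ≠ 0 := sub_ne_zero.2 (Ne.symm hne)
      rw [hparam hα, add_sub_cancel]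
      field_simp
      ring
    · rintro (rfl | ⟨α, hα, rfl⟩)
      · exact ⟨hx0Q, hx0⟩
      · obtain ⟨h1, h2⟩ := hsolα hα
        refine ⟨by rw [mul_pow, pow_right_comm, h1, hx0Q], ?_⟩
        rw [hparam hα, pow_succ]
        exact sub_one_div_isZero ha0 hx0ne hβ0 hβq hx0q (hw_ne h2) h2
  refine ⟨hset, ?_⟩
  have himage : {x : AlgebraicClosure (ZMod p) |
      ∃ α : AlgebraicClosure (ZMod p), α ^ p ^ Nat.gcd n k = α ∧
        x = (w0 + α) ^ (p ^ k - 1) * x0} =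
      (fun α => (w0 + α) ^ (p ^ k - 1) * x0) '' {α | α ^ p ^ Nat.gcd n k = α} := by
    ext x
    simp [eq_comm]
  have hfinite : {α : AlgebraicClosure (ZMod p) | α ^ p ^ Nat.gcd n k = α}.Finite :=
    Set.finite_of_ncard_ne_zero (by rw [hfix]; exact pow_ne_zero _ hp.ne_zero)
  rw [hset, himage, Set.ncard_insert_of_notMem _ (hfinite.image _), Set.InjOn.ncard_image, hfix]
  · intro α hα α' hα' h
    have h : (w0 + α) ^ (p ^ k - 1) * x0 = (w0 + α') ^ (p ^ k - 1) * x0 := h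
    rw [hparam hα, hparam hα', sub_right_inj, one_div, one_div, inv_inj] at h
    exact add_left_cancel (mul_left_cancel₀ hβ0 h)
  · rintro ⟨α, hα, h⟩
    have h : (w0 + α) ^ (p ^ k - 1) * x0 = x0 := h
    rw [hparam hα, sub_eq_self] at h
    exact one_div_ne_zero (mul_ne_zero hβ0 (hw_ne (hsolα hα).2)) h
end
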